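/- Let N : (0,∞) → ℝ be locally integrable with ∫₀^t |N(s)| ds ≤ p(t) (p a polynomial) for all t > 0, and suppose its Laplace transform N̂ satisfies Re N̂(λ) ≥ 0 for all λ with Re λ > 0. Let n be a positive integer and let z : [0,∞) → ℝ be locally absolutely continuous with z(0) = 1, z'(t) = −n² ∫₀^t N(t−s) z(s) ds almost everywhere, and |z(t)| ≤ 1 for all t. Then for every λ with Re λ > 0 one has λ + n² N̂(λ) ≠ 0, ∫₀^∞ e^(−λt) z(t) dt = 1/(λ + n² N̂(λ)), and ∫₀^∞ e^(−λt) z'(t) dt = −n² N̂(λ)/(λ + n² N̂(λ)). -/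

import Mathlib

open MeasureTheory Set Complex

/-- A function whose absolute integrals over `(0, t]` grow at most polynomially in `t` becomes
integrable after multiplication by a decaying exponential. -/
theorem integrableOn_exp_mul_of_integral_abs_le_polynomial {f : ℝ → ℝ} {p : Polynomial ℝ}
    (hf : ∀ T : ℝ, 0 < T → IntegrableOn f (Ioc 0 T))
    (hp : ∀ t : ℝ, 0 < t → (∫ s in (0 : ℝ)..t, |f s|) ≤ p.eval t) {l : ℂ} (hl : 0 < l.re) :
    IntegrableOn (fun t : ℝ => Complex.exp (-l * t) * (f t : ℂ)) (Ioi 0) := by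
  have hcover : (⋃ k : ℕ, Ioc (k : ℝ) (k + 1)) = Ioi 0 := by
    ext x
    simp only [mem_iUnion, mem_Ioc, mem_Ioi]
    constructor
    · rintro ⟨k, hk, -⟩
      exact (Nat.cast_nonneg k).trans_lt hk
    · intro hx
      refine ⟨⌈x⌉₊ - 1, ?_, ?_⟩
      · exact Nat.lt_ceil.1 (Nat.sub_lt (Nat.ceil_pos.2 hx) one_pos)
      · have h : ((⌈x⌉₊ - 1 : ℕ) : ℝ) + 1 = ⌈x⌉₊ := by
          exact_mod_cast Nat.sub_add_cancel (Nat.ceil_pos.2 hx)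
        rw [h]
        exact Nat.le_ceil x
  have hsub (k : ℕ) : Ioc (k : ℝ) (k + 1) ⊆ Ioc 0 (k + 1) :=
    Ioc_subset_Ioc_left (Nat.cast_nonneg k)
  have hfk (k : ℕ) : IntegrableOn f (Ioc 0 ((k : ℝ) + 1)) := hf _ (by positivity)
  have hexp (t : ℝ) : ‖Complex.exp (-l * t)‖ = Real.exp (-l.re * t) := by
    simp [Complex.norm_exp]
  have hint (k : ℕ) : IntegrableOn (fun t : ℝ => Complex.exp (-l * t) * (f t : ℂ))
      (Ioc (k : ℝ) (k + 1)) := by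
    refine Integrable.bdd_mul (c := 1) ((hfk k).mono_set (hsub k)).ofReal
      (by fun_prop) ?_
    filter_upwards [ae_restrict_mem measurableSet_Ioc] with t ht
    have : 0 < t := (Nat.cast_nonneg k).trans_lt ht.1
    rw [hexp, Real.exp_le_one_iff]
    nlinarith
  have hsum (q : Polynomial ℝ) :
      Summable fun k : ℕ => q.eval ((k : ℝ) + 1) * Real.exp (-l.re * k) := by
    induction q using Polynomial.induction_on' with
    | add q r hq hr => simpa [add_mul] using hq.add hr
    | monomial m a =>
      have h := ((summable_nat_add_iff 1).2
        (Real.summable_pow_mul_exp_neg_nat_mul m hl)).mul_left (a * Real.exp l.re)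
      refine h.congr fun k => ?_
      have : Real.exp (-l.re * k) = Real.exp l.re * Real.exp (-l.re * (k + 1)) := by
        rw [← Real.exp_add]; ring_nf
      simp only [Polynomial.eval_monomial, Nat.cast_add, Nat.cast_one, this]
      ring
  rw [← hcover]
  refine integrableOn_iUnion_of_summable_integral_norm hint ?_
  refine (hsum p).of_nonneg_of_le (fun k => integral_nonneg fun t => norm_nonneg _) fun k => ?_
  calc ∫ t in Ioc (k : ℝ) (k + 1), ‖Complex.exp (-l * t) * (f t : ℂ)‖
      ≤ ∫ t in Ioc (k : ℝ) (k + 1), |f t| * Real.exp (-l.re * k) := by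
        refine setIntegral_mono_on (hint k).norm
          (((hfk k).mono_set (hsub k)).abs.mul_const _) measurableSet_Ioc fun t ht => ?_
        rw [norm_mul, hexp, mul_comm, Complex.norm_real, Real.norm_eq_abs]
        gcongr ?_ * Real.exp ?_
        nlinarith [ht.1]
    _ = (∫ t in Ioc (k : ℝ) (k + 1), |f t|) * Real.exp (-l.re * k) := integral_mul_const _ _
    _ ≤ p.eval ((k : ℝ) + 1) * Real.exp (-l.re * k) := by
        gcongr
        refine le_trans ?_ (hp _ (by positivity))
        rw [intervalIntegral.integral_of_le (by positivity)]
        exact setIntegral_mono_set (hfk k).abs (ae_of_all _ fun t => abs_nonneg _)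
          (hsub k).eventuallyLE

/-- The exponential weight turns a real forward convolution into a complex forward convolution of
the weighted functions. -/
theorem exp_mul_integral_mul_comp_sub (f g : ℝ → ℝ) (l : ℂ) (t : ℝ) :
    Complex.exp (-l * t) * ((∫ s in (0 : ℝ)..t, f s * g (t - s) : ℝ) : ℂ) =
      ∫ s in (0 : ℝ)..t, ContinuousLinearMap.mul ℝ ℂ (Complex.exp (-l * s) * (f s : ℂ))
        (Complex.exp (-l * (t - s : ℝ)) * (g (t - s) : ℂ)) := by
  rw [← intervalIntegral.integral_ofReal, ← intervalIntegral.integral_const_mul]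
  congr 1 with s
  have : Complex.exp (-l * t) = Complex.exp (-l * s) * Complex.exp (-l * (t - s : ℝ)) := by
    rw [← Complex.exp_add]; push_cast; ring_nf
  rw [this, ContinuousLinearMap.mul_apply']
  push_cast
  ring

/-- The Laplace integrand of a forward convolution is integrable. -/
theorem integrableOn_exp_mul_convolution {f g : ℝ → ℝ} {l : ℂ}
    (hf : IntegrableOn (fun t : ℝ => Complex.exp (-l * t) * (f t : ℂ)) (Ioi 0))
    (hg : IntegrableOn (fun t : ℝ => Complex.exp (-l * t) * (g t : ℂ)) (Ioi 0)) :
    IntegrableOn (fun t : ℝ =>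
      Complex.exp (-l * t) * ((∫ s in (0 : ℝ)..t, f s * g (t - s) : ℝ) : ℂ)) (Ioi 0) := by
  simp_rw [exp_mul_integral_mul_comp_sub]
  exact (integrable_indicator_iff measurableSet_Ioi).1
    (integrable_posConvolution hf hg (ContinuousLinearMap.mul ℝ ℂ))

/-- The Laplace transform of a forward convolution is the product of the Laplace transforms. -/
theorem integral_exp_mul_convolution {f g : ℝ → ℝ} {l : ℂ}
    (hf : IntegrableOn (fun t : ℝ => Complex.exp (-l * t) * (f t : ℂ)) (Ioi 0))
    (hg : IntegrableOn (fun t : ℝ => Complex.exp (-l * t) * (g t : ℂ)) (Ioi 0)) :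
    ∫ t in Ioi (0 : ℝ), Complex.exp (-l * t) * ((∫ s in (0 : ℝ)..t, f s * g (t - s) : ℝ) : ℂ) =
      (∫ t in Ioi (0 : ℝ), Complex.exp (-l * t) * (f t : ℂ)) *
        ∫ t in Ioi (0 : ℝ), Complex.exp (-l * t) * (g t : ℂ) := by
  simp_rw [exp_mul_integral_mul_comp_sub]
  exact integral_posConvolution hf hg (ContinuousLinearMap.mul ℝ ℂ)

/-- The primitive from `0` of a locally integrable function on `(0, ∞)` is continuous on
`(0, ∞)`. -/
theorem continuousOn_Ioi_primitive {f : ℝ → ℝ}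
    (hf : ∀ T : ℝ, 0 < T → IntegrableOn f (Ioc 0 T)) :
    ContinuousOn (fun t => ∫ s in (0 : ℝ)..t, f s) (Ioi 0) := by
  intro t ht
  have ht : 0 < t := ht
  have h := intervalIntegral.continuousOn_primitive_interval (a := 0) (b := t + 1)
    (f := f) (μ := volume) (by
      rw [uIcc_of_le (by linarith), integrableOn_Icc_iff_integrableOn_Ioc]
      exact hf _ (by linarith))
  rw [uIcc_of_le (by linarith)] at h
  exact (h.continuousAt (Icc_mem_nhds ht (by linarith))).continuousWithinAt

/-- Laplace transform of the scalar solution `z` of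
`z' = −n² N∗z`, `z(0) = 1`: for `Re λ > 0`, `λ + n² N̂(λ) ≠ 0`,
`ẑ(λ) = 1/(λ + n² N̂(λ))` and `ẑ'(λ) = −n² N̂(λ)/(λ + n² N̂(λ))`. -/
theorem laplace_transform_of_z (N z z' : ℝ → ℝ) (p : Polynomial ℝ)
    (n : ℕ) (hn : 0 < n)
    (hNloc : ∀ T : ℝ, 0 < T → IntegrableOn N (Ioc 0 T))
    (hp : ∀ t : ℝ, 0 < t → (∫ s in (0 : ℝ)..t, |N s|) ≤ p.eval t)
    (hNhat : ∀ l : ℂ, 0 < l.re →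
      0 ≤ (∫ t in Ioi (0 : ℝ), Complex.exp (-l * t) * (N t : ℂ)).re)
    (hz'loc : ∀ T : ℝ, 0 < T → IntegrableOn z' (Ioc 0 T))
    (hz0 : z 0 = 1)
    (hrep : ∀ t : ℝ, 0 ≤ t → z t = 1 + ∫ s in (0 : ℝ)..t, z' s)
    (heq : ∀ᵐ t ∂(volume.restrict (Ioi (0 : ℝ))),
      z' t = -(n : ℝ) ^ 2 * ∫ s in (0 : ℝ)..t, N (t - s) * z s)
    (hzbd : ∀ t : ℝ, 0 ≤ t → |z t| ≤ 1) :
    ∀ l : ℂ, 0 < l.re →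
      l + (n : ℂ) ^ 2 * (∫ t in Ioi (0 : ℝ), Complex.exp (-l * t) * (N t : ℂ)) ≠ 0 ∧
      (∫ t in Ioi (0 : ℝ), Complex.exp (-l * t) * (z t : ℂ))
        = 1 / (l + (n : ℂ) ^ 2 * ∫ t in Ioi (0 : ℝ), Complex.exp (-l * t) * (N t : ℂ)) ∧
      (∫ t in Ioi (0 : ℝ), Complex.exp (-l * t) * (z' t : ℂ))
        = -((n : ℂ) ^ 2) * (∫ t in Ioi (0 : ℝ), Complex.exp (-l * t) * (N t : ℂ))
            / (l + (n : ℂ) ^ 2 * ∫ t in Ioi (0 : ℝ), Complex.exp (-l * t) * (N t : ℂ)) := by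
  intro l hl
  have hE : IntegrableOn (fun t : ℝ => Complex.exp (-l * t)) (Ioi 0) :=
    integrableOn_exp_mul_complex_Ioi (by simpa using hl) 0
  have hN := integrableOn_exp_mul_of_integral_abs_le_polynomial hNloc hp hl
  have hzmeas : AEStronglyMeasurable z (volume.restrict (Ioi 0)) := by
    refine ContinuousOn.aestronglyMeasurable ?_ measurableSet_Ioi
    exact (continuousOn_const.add (continuousOn_Ioi_primitive hz'loc)).congr
      fun t ht => hrep t (le_of_lt ht)
  have hz : IntegrableOn (fun t : ℝ => Complex.exp (-l * t) * (z t : ℂ)) (Ioi 0) := by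
    refine Integrable.mul_bdd (c := 1) hE
      (Complex.continuous_ofReal.comp_aestronglyMeasurable hzmeas) ?_
    filter_upwards [ae_restrict_mem measurableSet_Ioi] with t ht
    simpa using hzbd t (le_of_lt ht)
  have hae : (fun t : ℝ => Complex.exp (-l * t) * (z' t : ℂ)) =ᵐ[volume.restrict (Ioi 0)]
      fun t : ℝ => -(n : ℂ) ^ 2 *
        (Complex.exp (-l * t) * ((∫ s in (0 : ℝ)..t, z s * N (t - s) : ℝ) : ℂ)) := by
    filter_upwards [heq] with t ht
    simp_rw [ht, mul_comm (z _)]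
    push_cast
    ring
  have hz' : IntegrableOn (fun t : ℝ => Complex.exp (-l * t) * (z' t : ℂ)) (Ioi 0) :=
    ((integrableOn_exp_mul_convolution hz hN).const_mul _).congr hae.symm
  have hone : IntegrableOn (fun t : ℝ => Complex.exp (-l * t) * ((1 : ℝ) : ℂ)) (Ioi 0) := by
    simpa using hE
  have hEint : ∫ t in Ioi (0 : ℝ), Complex.exp (-l * t) = 1 / l := by
    rw [integral_exp_mul_complex_Ioi (by simpa using hl)]
    simp
  have hconv := integral_exp_mul_convolution hz hN
  have hprim := integral_exp_mul_convolution (g := fun _ => 1) hz' hone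
  have hprimint := integrableOn_exp_mul_convolution (g := fun _ => 1) hz' hone
  simp only [mul_one, Complex.ofReal_one] at hprim hprimint
  have hzhat : ∫ t in Ioi (0 : ℝ), Complex.exp (-l * t) * (z t : ℂ) =
      1 / l + (∫ t in Ioi (0 : ℝ), Complex.exp (-l * t) * (z' t : ℂ)) * (1 / l) := by
    rw [← hEint, ← hprim, ← integral_add hE hprimint]
    refine setIntegral_congr_fun measurableSet_Ioi fun t ht => ?_
    simp only [hrep t (le_of_lt ht)]
    push_cast
    ring
  have hz'hat := integral_congr_ae hae
  rw [integral_const_mul, hconv] at hz'hat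
  have hre := hNhat l hl
  clear hconv hprim
  generalize (∫ t in Ioi (0 : ℝ), Complex.exp (-l * t) * (N t : ℂ)) = A at *
  generalize (∫ t in Ioi (0 : ℝ), Complex.exp (-l * t) * (z t : ℂ)) = Z at *
  generalize (∫ t in Ioi (0 : ℝ), Complex.exp (-l * t) * (z' t : ℂ)) = Z' at *
  have hne : l + (n : ℂ) ^ 2 * A ≠ 0 := by
    intro h
    have h' := congrArg Complex.re h
    have hn2 : ((n : ℂ) ^ 2 * A).re = (n : ℝ) ^ 2 * A.re := by
      rw [← Complex.ofReal_natCast, ← Complex.ofReal_pow, Complex.re_ofReal_mul]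
    rw [Complex.add_re, hn2, Complex.zero_re] at h'
    have : 0 ≤ (n : ℝ) ^ 2 * A.re := by positivity
    linarith
  have hl0 : l ≠ 0 := fun h => by simp [h] at hl
  field_simp at hzhat
  have hZ : Z = 1 / (l + (n : ℂ) ^ 2 * A) := by
    rw [eq_div_iff hne]
    linear_combination hzhat + hz'hat
  refine ⟨hne, hZ, ?_⟩
  rw [hz'hat, hZ]
  ring
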